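/- Let K be a field of characteristic 2, let A = K[U,V,W,X,Y,Z]_m/(UX+VY+WZ) be the localization of K[U,V,W,X,Y,Z]/(UX+VY+WZ) at the maximal ideal m = (U,V,W,X,Y,Z), with u,v,w,x,y,z the images of the variables, let Ω be an algebraic closure of Frac(A), let a, b, c, d, e ∈ Ω be the square roots of uyz, vxz, wxy, uvw, vwyz respectively, let R = A[a,b,c,d,e] ⊆ Ω, and let I = (u, x, v, y, w−z)R. Then the socle of R/I, namely the K-subspace of R/I consisting of the elements annihilated by the images of each of u, v, w, x, y, z, a, b, c, d, e, is one-dimensional over K, spanned by the image of ze. -/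

import Mathlib

open MvPolynomial

set_option maxHeartbeats 1000000
set_option synthInstance.maxHeartbeats 1000000

noncomputable section

/-- The polynomial `UX + VY + WZ` (variables: `0 = U, 1 = V, 2 = W, 3 = X, 4 = Y, 5 = Z`). -/
def bPoly (K : Type) [Field K] : MvPolynomial (Fin 6) K :=
  X 0 * X 3 + X 1 * X 4 + X 2 * X 5

/-- The hypersurface `K[U,V,W,X,Y,Z]/(UX+VY+WZ)`. -/
def Bring (K : Type) [Field K] : Type :=
  MvPolynomial (Fin 6) K ⧸ Ideal.span {bPoly K}

instance (K : Type) [Field K] : CommRing (Bring K) :=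
  inferInstanceAs (CommRing (MvPolynomial (Fin 6) K ⧸ Ideal.span {bPoly K}))

/-- The quotient map onto the hypersurface. -/
def bMk (K : Type) [Field K] : MvPolynomial (Fin 6) K →+* Bring K :=
  Ideal.Quotient.mk (Ideal.span {bPoly K})

/-- The maximal ideal of `Bring K` generated by the images of the variables. -/
def mIdeal (K : Type) [Field K] : Ideal (Bring K) :=
  Ideal.span (Set.range fun i : Fin 6 => bMk K (X i))

/-- `A`, the localization of the hypersurface at the maximal ideal `m`. -/
def Aring (K : Type) [Field K] [(mIdeal K).IsPrime] : Type :=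
  Localization (mIdeal K).primeCompl

instance (K : Type) [Field K] [(mIdeal K).IsPrime] : CommRing (Aring K) :=
  inferInstanceAs (CommRing (Localization (mIdeal K).primeCompl))

instance (K : Type) [Field K] [(mIdeal K).IsPrime] : Algebra (Bring K) (Aring K) :=
  inferInstanceAs (Algebra (Bring K) (Localization (mIdeal K).primeCompl))

variable (K : Type) [Field K] [(mIdeal K).IsPrime]

/-- `u`, the image of `U` in `A`. -/
def uElt : Aring K := algebraMap (Bring K) (Aring K) (bMk K (X 0))
/-- `v`, the image of `V` in `A`. -/
def vElt : Aring K := algebraMap (Bring K) (Aring K) (bMk K (X 1))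
/-- `w`, the image of `W` in `A`. -/
def wElt : Aring K := algebraMap (Bring K) (Aring K) (bMk K (X 2))
/-- `x`, the image of `X` in `A`. -/
def xElt : Aring K := algebraMap (Bring K) (Aring K) (bMk K (X 3))
/-- `y`, the image of `Y` in `A`. -/
def yElt : Aring K := algebraMap (Bring K) (Aring K) (bMk K (X 4))
/-- `z`, the image of `Z` in `A`. -/
def zElt : Aring K := algebraMap (Bring K) (Aring K) (bMk K (X 5))

/-- The ideal `P = (u, v, w)` of `A`. -/
def Pideal : Ideal (Aring K) := Ideal.span {uElt K, vElt K, wElt K}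

/-- `L = Frac(A)`, the fraction field of `A`. -/
def Lfield (K : Type) [Field K] [(mIdeal K).IsPrime] : Type :=
  FractionRing (Aring K)

instance (K : Type) [Field K] [(mIdeal K).IsPrime] [IsDomain (Aring K)] :
    Field (Lfield K) := inferInstanceAs (Field (FractionRing (Aring K)))

instance (K : Type) [Field K] [(mIdeal K).IsPrime] [IsDomain (Aring K)] :
    Algebra (Aring K) (Lfield K) := inferInstanceAs (Algebra (Aring K) (FractionRing (Aring K)))

variable (K : Type) [Field K] [(mIdeal K).IsPrime] [IsDomain (Aring K)]

/-- `Ω`, an algebraic closure of `L`. -/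
def Omega : Type := AlgebraicClosure (Lfield K)

instance : Field (Omega K) := inferInstanceAs (Field (AlgebraicClosure (Lfield K)))

instance : Algebra (Lfield K) (Omega K) :=
  inferInstanceAs (Algebra (Lfield K) (AlgebraicClosure (Lfield K)))

instance : IsAlgClosed (Omega K) := inferInstanceAs (IsAlgClosed (AlgebraicClosure (Lfield K)))

instance : Algebra.IsAlgebraic (Lfield K) (Omega K) :=
  inferInstanceAs (Algebra.IsAlgebraic (Lfield K) (AlgebraicClosure (Lfield K)))

instance : Algebra (Aring K) (Omega K) :=
  ((algebraMap (Lfield K) (Omega K)).comp (algebraMap (Aring K) (Lfield K))).toAlgebra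

/-- The image of an element of `A` in `Ω`. -/
def toOmega (α : Aring K) : Omega K := algebraMap (Aring K) (Omega K) α

variable (a b c d e : Omega K)

/-- The subring `R = A[a,b,c,d,e]` of `Ω`. -/
def adjoinT : Subalgebra (Aring K) (Omega K) :=
  Algebra.adjoin (Aring K) {a, b, c, d, e}

/-- The image of `u` in `R`. -/
def uT : adjoinT K a b c d e := algebraMap (Aring K) (adjoinT K a b c d e) (uElt K)
/-- The image of `v` in `R`. -/
def vT : adjoinT K a b c d e := algebraMap (Aring K) (adjoinT K a b c d e) (vElt K)
/-- The image of `w` in `R`. -/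
def wT : adjoinT K a b c d e := algebraMap (Aring K) (adjoinT K a b c d e) (wElt K)
/-- The image of `x` in `R`. -/
def xT : adjoinT K a b c d e := algebraMap (Aring K) (adjoinT K a b c d e) (xElt K)
/-- The image of `y` in `R`. -/
def yT : adjoinT K a b c d e := algebraMap (Aring K) (adjoinT K a b c d e) (yElt K)
/-- The image of `z` in `R`. -/
def zT : adjoinT K a b c d e := algebraMap (Aring K) (adjoinT K a b c d e) (zElt K)

/-- `a` as an element of `R`. -/
def aT : adjoinT K a b c d e := ⟨a, Algebra.subset_adjoin (by simp)⟩
/-- `b` as an element of `R`. -/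
def bT : adjoinT K a b c d e := ⟨b, Algebra.subset_adjoin (by simp)⟩
/-- `c` as an element of `R`. -/
def cT : adjoinT K a b c d e := ⟨c, Algebra.subset_adjoin (by simp)⟩
/-- `d` as an element of `R`. -/
def dT : adjoinT K a b c d e := ⟨d, Algebra.subset_adjoin (by simp)⟩
/-- `e` as an element of `R`. -/
def eT : adjoinT K a b c d e := ⟨e, Algebra.subset_adjoin (by simp)⟩

instance (K : Type) [Field K] [(mIdeal K).IsPrime] : Algebra K (Aring K) :=
  ((algebraMap (Bring K) (Aring K)).comp
    ((bMk K).comp (algebraMap K (MvPolynomial (Fin 6) K)))).toAlgebra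

/-- The ideal `I = (u, x, v, y, w−z)` of `R = A[a,b,c,d,e]`. -/
def Iideal (K : Type) [Field K] [(mIdeal K).IsPrime] [IsDomain (Aring K)]
    (a b c d e : Omega K) : Ideal (adjoinT K a b c d e) :=
  Ideal.span {uT K a b c d e, xT K a b c d e, vT K a b c d e, yT K a b c d e,
    wT K a b c d e - zT K a b c d e}

/-- The structure map `K → R/I`. -/
def kToQuot (K : Type) [Field K] [(mIdeal K).IsPrime] [IsDomain (Aring K)]
    (a b c d e : Omega K) : K →+* (adjoinT K a b c d e ⧸ Iideal K a b c d e) :=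
  ((Ideal.Quotient.mk (Iideal K a b c d e)).comp
    (algebraMap (Aring K) (adjoinT K a b c d e))).comp (algebraMap K (Aring K))

lemma bMk_surjective (K : Type) [Field K] : Function.Surjective (bMk K) :=
  Ideal.Quotient.mk_surjective

lemma bMk_eq_zero_iff (K : Type) [Field K] (f : MvPolynomial (Fin 6) K) :
    bMk K f = 0 ↔ bPoly K ∣ f :=
  Ideal.Quotient.eq_zero_iff_mem.trans Ideal.mem_span_singleton

lemma bMk_mem_mIdeal (K : Type) [Field K] {t : MvPolynomial (Fin 6) K} (ht : constantCoeff t = 0) :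
    bMk K t ∈ mIdeal K := by
  have h : t ∈ Ideal.span (Set.range (X : Fin 6 → MvPolynomial (Fin 6) K)) := by
    rw [← Set.image_univ, mem_ideal_span_X_image]
    intro m hm
    by_contra! hc
    have : m = 0 := by ext i; exact hc i (Set.mem_univ i)
    subst this
    exact (mem_support_iff.1 hm) ht
  have := Ideal.mem_map_of_mem (bMk K) h
  rwa [Ideal.map_span, ← Set.range_comp] at this

/-- The canonical map from the polynomial ring to `A`. -/
def polyToA (K : Type) [Field K] [(mIdeal K).IsPrime] : MvPolynomial (Fin 6) K →+* Aring K :=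
  (algebraMap (Bring K) (Aring K)).comp (bMk K)

section Localization

variable (K : Type) [Field K] [(mIdeal K).IsPrime]

instance : IsLocalization (mIdeal K).primeCompl (Aring K) :=
  inferInstanceAs (IsLocalization (mIdeal K).primeCompl (Localization (mIdeal K).primeCompl))

@[simp] lemma polyToA_X_zero : polyToA K (X 0) = uElt K := rfl
@[simp] lemma polyToA_X_one : polyToA K (X 1) = vElt K := rfl
@[simp] lemma polyToA_X_two : polyToA K (X 2) = wElt K := rfl
@[simp] lemma polyToA_X_three : polyToA K (X 3) = xElt K := rfl
@[simp] lemma polyToA_X_four : polyToA K (X 4) = yElt K := rfl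
@[simp] lemma polyToA_X_five : polyToA K (X 5) = zElt K := rfl

lemma polyToA_bPoly : polyToA K (bPoly K) = 0 := by
  rw [polyToA, RingHom.comp_apply, (bMk_eq_zero_iff K _).2 dvd_rfl, map_zero]

lemma quadric_relation :
    uElt K * xElt K + vElt K * yElt K + wElt K * zElt K = 0 := by
  have h := polyToA_bPoly K
  simpa [bPoly] using h

lemma two_eq_zero_A [CharP K 2] : (2 : Aring K) = 0 := by
  have h : (2 : K) = 0 := CharTwo.two_eq_zero
  rw [← map_ofNat (algebraMap K (Aring K)) 2, h, map_zero]

lemma exists_poly_fraction (α : Aring K) :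
    ∃ p t : MvPolynomial (Fin 6) K, bMk K t ∈ (mIdeal K).primeCompl ∧
      α * polyToA K t = polyToA K p := by
  obtain ⟨⟨p, t⟩, h⟩ := IsLocalization.surj (mIdeal K).primeCompl α
  obtain ⟨p', rfl⟩ := bMk_surjective K p
  obtain ⟨t', ht⟩ := bMk_surjective K (t : Bring K)
  exact ⟨p', t', ht ▸ t.2, by simpa [polyToA, ht] using h⟩

lemma isUnit_polyToA {t : MvPolynomial (Fin 6) K} (ht : bMk K t ∈ (mIdeal K).primeCompl) :
    IsUnit (polyToA K t) :=
  IsLocalization.map_units (Aring K) (⟨_, ht⟩ : (mIdeal K).primeCompl)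

lemma exists_mul_eq_of_polyToA_eq_zero {f : MvPolynomial (Fin 6) K} (hf : polyToA K f = 0) :
    ∃ t h, IsUnit (polyToA K t) ∧ t * f = bPoly K * h := by
  obtain ⟨t, ht⟩ :=
    (IsLocalization.map_eq_zero_iff (mIdeal K).primeCompl (Aring K) (bMk K f)).1 hf
  obtain ⟨t', ht'⟩ := bMk_surjective K (t : Bring K)
  rw [← ht', ← map_mul, bMk_eq_zero_iff] at ht
  obtain ⟨h, hh⟩ := ht
  exact ⟨t', h, isUnit_polyToA K (ht' ▸ t.2), hh⟩

/-- A derivation of the polynomial ring killing `UX + VY + WZ` preserves the kernel of the map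
to `A`. -/
lemma polyToA_derivation_eq_zero
    (D : Derivation K (MvPolynomial (Fin 6) K) (MvPolynomial (Fin 6) K))
    (hD : D (bPoly K) = 0) {f : MvPolynomial (Fin 6) K} (hf : polyToA K f = 0) :
    polyToA K (D f) = 0 := by
  obtain ⟨t, h, ht, hth⟩ := exists_mul_eq_of_polyToA_eq_zero K hf
  have h1 := congrArg (fun g => polyToA K (D g)) hth
  simp only [Derivation.leibniz, hD, smul_eq_mul, mul_zero, add_zero, map_add, map_mul, hf,
    polyToA_bPoly, zero_mul] at h1
  exact (ht.mul_right_eq_zero).1 h1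

/-- Every scaling of the six coordinates gives a tangent vector of the hypersurface at the
origin. -/
lemma exists_hom_dualNumber (s : Fin 6 → K) :
    ∃ φ : Aring K →+* DualNumber K, ∀ i, φ (polyToA K (X i)) = s i • DualNumber.eps := by
  let f : MvPolynomial (Fin 6) K →+* DualNumber K :=
    (aeval fun i => s i • (DualNumber.eps : DualNumber K)).toRingHom
  have hX : ∀ i, f (X i) = s i • DualNumber.eps := fun i => by simp [f]
  have hb : ∀ g ∈ Ideal.span {bPoly K}, f g = 0 := by
    intro g hg
    obtain ⟨h, rfl⟩ := Ideal.mem_span_singleton.1 hg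
    simp [bPoly, hX]
  let g : Bring K →+* DualNumber K := Ideal.Quotient.lift _ f hb
  have hg : ∀ p, g (bMk K p) = f p := fun p => Ideal.Quotient.lift_mk _ _ _
  have hfst : ∀ p, (f p).fst = constantCoeff p := by
    intro p
    induction p using MvPolynomial.induction_on with
    | C k => simp [f, TrivSqZeroExt.algebraMap_eq_inl]
    | add p q hp hq => simp [hp, hq]
    | mul_X p i hp => simp [hX]
  have hu : ∀ y : (mIdeal K).primeCompl, IsUnit (g y) := by
    intro y
    obtain ⟨p, hp⟩ := bMk_surjective K (y : Bring K)
    rw [← hp, hg, TrivSqZeroExt.isUnit_iff_isUnit_fst, hfst, isUnit_iff_ne_zero]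
    intro h0
    exact y.2 (hp ▸ bMk_mem_mIdeal K h0)
  refine ⟨IsLocalization.lift hu, fun i => ?_⟩
  rw [polyToA, RingHom.comp_apply, IsLocalization.lift_eq, hg, hX]

lemma polyToA_X_ne_zero (i : Fin 6) : polyToA K (X i) ≠ 0 := by
  obtain ⟨φ, hφ⟩ := exists_hom_dualNumber K fun _ => 1
  intro h
  have h1 := hφ i
  rw [h, map_zero, one_smul] at h1
  simpa using congrArg TrivSqZeroExt.snd h1

/-- The parameter ideal `(u, x, v, y, w - z)` of `A`. -/
def paramIdeal : Ideal (Aring K) :=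
  Ideal.span {uElt K, xElt K, vElt K, yElt K, wElt K - zElt K}

lemma zElt_notMem_paramIdeal : zElt K ∉ paramIdeal K := by
  obtain ⟨φ, hφ⟩ := exists_hom_dualNumber K ![0, 0, 1, 0, 0, 1]
  have hle : paramIdeal K ≤ RingHom.ker φ := by
    refine Ideal.span_le.2 ?_
    rintro g (rfl | rfl | rfl | rfl | rfl) <;> rw [SetLike.mem_coe, RingHom.mem_ker]
    · exact (hφ 0).trans (by simp)
    · exact (hφ 3).trans (by simp)
    · exact (hφ 1).trans (by simp)
    · exact (hφ 4).trans (by simp)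
    · rw [map_sub, sub_eq_zero]
      exact (hφ 2).trans ((by simp : _ = _).trans (hφ 5).symm)
  intro hz
  have h5 : φ (zElt K) = _ := hφ 5
  rw [RingHom.mem_ker.1 (hle hz)] at h5
  simpa using congrArg TrivSqZeroExt.snd h5

lemma zElt_sq_mem_paramIdeal : zElt K ^ 2 ∈ paramIdeal K := by
  have hu : uElt K ∈ paramIdeal K := Ideal.subset_span (by simp)
  have hv : vElt K ∈ paramIdeal K := Ideal.subset_span (by simp)
  have hw : wElt K - zElt K ∈ paramIdeal K := Ideal.subset_span (by simp)
  have h : zElt K ^ 2 =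
      -(xElt K * uElt K) - yElt K * vElt K - zElt K * (wElt K - zElt K) := by
    linear_combination quadric_relation K
  rw [h]
  exact sub_mem (sub_mem (neg_mem (Ideal.mul_mem_left _ _ hu)) (Ideal.mul_mem_left _ _ hv))
    (Ideal.mul_mem_left _ _ hw)

/-- Modulo `(u, x, v, y, w - z)`, every polynomial is of the form `k + l z` with `k, l ∈ K`. -/
lemma exists_polyToA_sub_mem (p : MvPolynomial (Fin 6) K) :
    ∃ k l : K, polyToA K p - (polyToA K (C k) + polyToA K (C l) * zElt K) ∈ paramIdeal K := by
  have hX : ∀ i, ∃ l : K, polyToA K (X i) - polyToA K (C l) * zElt K ∈ paramIdeal K := by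
    intro i
    fin_cases i
    · exact ⟨0, by simpa [paramIdeal] using (Ideal.subset_span (by simp) : uElt K ∈ paramIdeal K)⟩
    · exact ⟨0, by simpa [paramIdeal] using (Ideal.subset_span (by simp) : vElt K ∈ paramIdeal K)⟩
    · exact ⟨1, by
        simpa [paramIdeal] using (Ideal.subset_span (by simp) : wElt K - zElt K ∈ paramIdeal K)⟩
    · exact ⟨0, by simpa [paramIdeal] using (Ideal.subset_span (by simp) : xElt K ∈ paramIdeal K)⟩
    · exact ⟨0, by simpa [paramIdeal] using (Ideal.subset_span (by simp) : yElt K ∈ paramIdeal K)⟩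
    · exact ⟨1, by simp⟩
  induction p using MvPolynomial.induction_on with
  | C k => exact ⟨k, 0, by simp⟩
  | add p q hp hq =>
    obtain ⟨k, l, h⟩ := hp
    obtain ⟨k', l', h'⟩ := hq
    refine ⟨k + k', l + l', ?_⟩
    convert add_mem h h' using 1
    simp only [map_add]
    ring
  | mul_X p i hp =>
    obtain ⟨k, l, h⟩ := hp
    obtain ⟨l', h'⟩ := hX i
    refine ⟨0, k * l', ?_⟩
    convert add_mem (add_mem (Ideal.mul_mem_left _ (polyToA K (X i)) h)
      (Ideal.mul_mem_left _ (polyToA K (C k) + polyToA K (C l) * zElt K) h'))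
      (Ideal.mul_mem_left _ (polyToA K (C l) * polyToA K (C l')) (zElt_sq_mem_paramIdeal K))
      using 1
    simp only [map_mul, map_zero]
    ring

lemma exists_sub_mem_paramIdeal (α : Aring K) :
    ∃ k l : K, α - (algebraMap K (Aring K) k + algebraMap K (Aring K) l * zElt K) ∈
      paramIdeal K := by
  have hC : ∀ k, polyToA K (C k) = algebraMap K (Aring K) k := fun _ => rfl
  obtain ⟨p, t, ht, hα⟩ := exists_poly_fraction K α
  obtain ⟨k, l, hp⟩ := exists_polyToA_sub_mem K p
  obtain ⟨m, n, hm⟩ := exists_polyToA_sub_mem K t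
  have hm0 : m ≠ 0 := by
    rintro rfl
    have hsq : polyToA K t ^ 2 ∈ paramIdeal K := by
      convert add_mem (Ideal.mul_mem_left _ (polyToA K t + polyToA K (C n) * zElt K) hm)
        (Ideal.mul_mem_left _ (polyToA K (C n) ^ 2) (zElt_sq_mem_paramIdeal K)) using 1
      simp only [map_zero]
      ring
    have htop := Ideal.eq_top_of_isUnit_mem _ hsq ((isUnit_polyToA K ht).pow 2)
    exact zElt_notMem_paramIdeal K (htop ▸ Submodule.mem_top)
  have hmm : algebraMap K (Aring K) m * algebraMap K (Aring K) m⁻¹ = 1 := by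
    rw [← map_mul, mul_inv_cancel₀ hm0, map_one]
  simp only [hC] at hp hm
  refine ⟨k * m⁻¹, l * m⁻¹ - k * n * m⁻¹ ^ 2, ?_⟩
  simp only [map_sub, map_mul, map_pow]
  generalize algebraMap K (Aring K) k = k, algebraMap K (Aring K) l = l,
    algebraMap K (Aring K) n = n, algebraMap K (Aring K) m = m,
    algebraMap K (Aring K) m⁻¹ = m' at *
  have key : α - (k * m' + (l * m' - k * n * m' ^ 2) * zElt K) =
      -(α * (m' - n * m' ^ 2 * zElt K)) * (polyToA K t - (m + n * zElt K)) +
      (m' - n * m' ^ 2 * zElt K) * (polyToA K p - (k + l * zElt K)) +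
      (α * n ^ 2 * m' ^ 2 - l * n * m' ^ 2) * zElt K ^ 2 := by
    linear_combination (m' - n * m' ^ 2 * zElt K) * hα + (-α + α * n * m' * zElt K) * hmm
  rw [key]
  exact add_mem (add_mem (Ideal.mul_mem_left _ _ hm) (Ideal.mul_mem_left _ _ hp))
    (Ideal.mul_mem_left _ _ (zElt_sq_mem_paramIdeal K))

/-- `vwyz` is not in the span of `1, uyz, vxz` over the squares of `Frac(A)`. -/
lemma eq_zero_of_sq_combination [CharP K 2] [IsDomain (Aring K)] {p q r s : Aring K}
    (h : p ^ 2 * (vElt K * wElt K * yElt K * zElt K) =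
      q ^ 2 + r ^ 2 * (uElt K * yElt K * zElt K) + s ^ 2 * (vElt K * xElt K * zElt K)) :
    p = 0 := by
  obtain ⟨p', t₁, ht₁, hp⟩ := exists_poly_fraction K p
  obtain ⟨q', t₂, ht₂, hq⟩ := exists_poly_fraction K q
  obtain ⟨r', t₃, ht₃, hr⟩ := exists_poly_fraction K r
  obtain ⟨s', t₄, ht₄, hs⟩ := exists_poly_fraction K s
  have hu : uElt K ≠ 0 := polyToA_X_ne_zero K 0
  have hv : vElt K ≠ 0 := polyToA_X_ne_zero K 1
  have hx : xElt K ≠ 0 := polyToA_X_ne_zero K 3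
  have hy : yElt K ≠ 0 := polyToA_X_ne_zero K 4
  have hz : zElt K ≠ 0 := polyToA_X_ne_zero K 5
  let D₁ : Derivation K (MvPolynomial (Fin 6) K) (MvPolynomial (Fin 6) K) :=
    mkDerivation K ![X 5 * X 0, 0, X 0 * X 3, 0, 0, 0]
  let D₂ : Derivation K (MvPolynomial (Fin 6) K) (MvPolynomial (Fin 6) K) :=
    mkDerivation K ![0, X 5 * X 1, X 1 * X 4, 0, 0, 0]
  have hX₁ : ∀ i, D₁ (X i) = _ := fun i => mkDerivation_X K _ i
  have hX₂ : ∀ i, D₂ (X i) = _ := fun i => mkDerivation_X K _ i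
  have h2 : (2 : MvPolynomial (Fin 6) K) = 0 := CharTwo.two_eq_zero
  clear_value D₁ D₂
  have hsq : ∀ (D : Derivation K (MvPolynomial (Fin 6) K) (MvPolynomial (Fin 6) K)) (f),
      D (f ^ 2) = 0 := fun D f => by
    rw [Derivation.leibniz_pow, ← Nat.cast_smul_eq_nsmul K, CharP.cast_eq_zero, zero_smul]
  have hD₁ : D₁ (bPoly K) = 0 := by
    simp only [bPoly, map_add, Derivation.leibniz, hX₁]
    simp
    linear_combination (X 0 * X 3 * X 5 : MvPolynomial (Fin 6) K) * h2
  have hD₂ : D₂ (bPoly K) = 0 := by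
    simp only [bPoly, map_add, Derivation.leibniz, hX₂]
    simp
    linear_combination (X 1 * X 4 * X 5 : MvPolynomial (Fin 6) K) * h2
  obtain ⟨P, hP⟩ : ∃ f, f = p' * t₂ * t₃ * t₄ := ⟨_, rfl⟩
  obtain ⟨Q, hQ⟩ : ∃ f, f = q' * t₁ * t₃ * t₄ := ⟨_, rfl⟩
  obtain ⟨R, hR⟩ : ∃ f, f = r' * t₁ * t₂ * t₄ := ⟨_, rfl⟩
  obtain ⟨S, hS⟩ : ∃ f, f = s' * t₁ * t₂ * t₃ := ⟨_, rfl⟩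
  have h₀ : polyToA K (P ^ 2 * (X 1 * X 2 * X 4 * X 5) - (Q ^ 2 + R ^ 2 * (X 0 * X 4 * X 5) +
      S ^ 2 * (X 1 * X 3 * X 5))) = 0 := by
    simp only [map_sub, map_add, map_mul, map_pow, hP, hQ, hR, hS, ← hp, ← hq, ← hr, ← hs,
      polyToA_X_zero, polyToA_X_one, polyToA_X_two, polyToA_X_three, polyToA_X_four,
      polyToA_X_five]
    linear_combination (polyToA K t₁ * polyToA K t₂ * polyToA K t₃ * polyToA K t₄) ^ 2 * h
  have h₁ : polyToA K (P ^ 2 * (X 1 * X 3) - R ^ 2 * X 5) = 0 := by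
    have h' := polyToA_derivation_eq_zero K D₁ hD₁ h₀
    simp only [map_sub, map_add, Derivation.leibniz, hsq, hX₁, smul_eq_mul] at h'
    simp at h'
    simp only [map_sub, map_mul, map_pow, polyToA_X_one, polyToA_X_three, polyToA_X_five]
    refine (mul_eq_zero.1 ?_).resolve_left (mul_ne_zero (mul_ne_zero hu hy) hz)
    linear_combination h'
  have h₂ : polyToA K P = 0 := by
    have h' := polyToA_derivation_eq_zero K D₂ hD₂ h₁
    simp only [map_sub, map_add, Derivation.leibniz, hsq, hX₂, smul_eq_mul] at h'
    simpa [hx, hv, hz] using h'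
  have hpt : p * (polyToA K t₁ * polyToA K t₂ * polyToA K t₃ * polyToA K t₄) = 0 := by
    rw [← h₂]
    simp only [hP, map_mul, ← hp]
    ring
  exact (((((isUnit_polyToA K ht₁).mul (isUnit_polyToA K ht₂)).mul
    (isUnit_polyToA K ht₃)).mul (isUnit_polyToA K ht₄)).mul_left_eq_zero).1 hpt

end Localization

/-- The multiplication table of `1, a, b, c, d, e` and the linear relations between `a, b, c, d`. -/
structure SquareRootRelations {S : Type*} [CommRing S] (u v w x y z a b c d e : S) : Prop where
  quadric : u * x + v * y + w * z = 0
  a_sq : a ^ 2 = u * y * z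
  b_sq : b ^ 2 = v * x * z
  c_sq : c ^ 2 = w * x * y
  d_sq : d ^ 2 = u * v * w
  e_sq : e ^ 2 = v * w * y * z
  a_mul_b : a * b = z * (e + v * y)
  a_mul_c : a * c = y * (e + w * z)
  a_mul_d : a * d = u * e
  a_mul_e : a * e = y * z * d
  b_mul_c : b * c = x * e
  b_mul_d : b * d = v * (e + w * z)
  b_mul_e : b * e = v * z * c
  c_mul_d : c * d = w * (e + v * y)
  c_mul_e : c * e = w * y * b
  d_mul_e : d * e = v * w * a
  linear_abc : x * a + y * b + z * c = 0
  linear_bcd : w * b + v * c + x * d = 0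
  linear_acd : w * a + u * c + y * d = 0
  linear_abd : v * a + u * b + z * d = 0

namespace SquareRootRelations

section CommRing

variable {S : Type*} [CommRing S] {u v w x y z a b c d e : S}

lemma of_sq [IsDomain S] (h2 : (2 : S) = 0) (h : u * x + v * y + w * z = 0)
    (ha : a ^ 2 = u * y * z) (hb : b ^ 2 = v * x * z) (hc : c ^ 2 = w * x * y)
    (hd : d ^ 2 = u * v * w) (he : e ^ 2 = v * w * y * z) :
    SquareRootRelations u v w x y z a b c d e := by
  have inj : ∀ {s t : S}, s ^ 2 = t ^ 2 → s = t := fun {s t} hst =>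
    sub_eq_zero.1 (pow_eq_zero_iff two_ne_zero |>.1
      (by linear_combination hst + (t ^ 2 - s * t) * h2))
  have sq0 : ∀ {s : S}, s ^ 2 = 0 → s = 0 := fun hs => pow_eq_zero_iff two_ne_zero |>.1 hs
  refine ⟨h, ha, hb, hc, hd, he, inj ?_, inj ?_, inj ?_, inj ?_, inj ?_, inj ?_, inj ?_, inj ?_,
    inj ?_, inj ?_, sq0 ?_, sq0 ?_, sq0 ?_, sq0 ?_⟩
  · linear_combination b ^ 2 * ha + u * y * z * hb - z ^ 2 * he + z ^ 2 * v * y * h -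
      (z ^ 2 * v * y * (w * z + v * y) + z ^ 2 * e * v * y) * h2
  · linear_combination c ^ 2 * ha + u * y * z * hc - y ^ 2 * he + y ^ 2 * w * z * h -
      (y ^ 2 * w * z * (w * z + v * y) + y ^ 2 * e * w * z) * h2
  · linear_combination d ^ 2 * ha + u * y * z * hd - u ^ 2 * he
  · linear_combination e ^ 2 * ha + u * y * z * he - (y * z) ^ 2 * hd
  · linear_combination c ^ 2 * hb + v * x * z * hc - x ^ 2 * he
  · linear_combination d ^ 2 * hb + v * x * z * hd - v ^ 2 * he + v ^ 2 * w * z * h -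
      (v ^ 2 * w * z * (w * z + v * y) + v ^ 2 * e * w * z) * h2
  · linear_combination e ^ 2 * hb + v * x * z * he - (v * z) ^ 2 * hc
  · linear_combination d ^ 2 * hc + w * x * y * hd - w ^ 2 * he + w ^ 2 * v * y * h -
      (w ^ 2 * v * y * (w * z + v * y) + w ^ 2 * e * v * y) * h2
  · linear_combination e ^ 2 * hc + w * x * y * he - (w * y) ^ 2 * hb
  · linear_combination e ^ 2 * hd + u * v * w * he - (v * w) ^ 2 * ha
  · linear_combination x ^ 2 * ha + y ^ 2 * hb + z ^ 2 * hc + x * y * z * h +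
      (x * a * (y * b) + x * a * (z * c) + y * b * (z * c)) * h2
  · linear_combination w ^ 2 * hb + v ^ 2 * hc + x ^ 2 * hd + v * w * x * h +
      (w * b * (v * c) + w * b * (x * d) + v * c * (x * d)) * h2
  · linear_combination w ^ 2 * ha + u ^ 2 * hc + y ^ 2 * hd + u * w * y * h +
      (w * a * (u * c) + w * a * (y * d) + u * c * (y * d)) * h2
  · linear_combination v ^ 2 * ha + u ^ 2 * hb + z ^ 2 * hd + u * v * z * h +
      (v * a * (u * b) + v * a * (z * d) + u * b * (z * d)) * h2

lemma map {T : Type*} [CommRing T] (f : S →+* T) (h : SquareRootRelations u v w x y z a b c d e) :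
    SquareRootRelations (f u) (f v) (f w) (f x) (f y) (f z) (f a) (f b) (f c) (f d) (f e) := by
  constructor <;> simp only [← map_mul, ← map_add, ← map_pow]
  · rw [h.quadric, map_zero]
  · rw [h.a_sq]
  · rw [h.b_sq]
  · rw [h.c_sq]
  · rw [h.d_sq]
  · rw [h.e_sq]
  · rw [h.a_mul_b]
  · rw [h.a_mul_c]
  · rw [h.a_mul_d]
  · rw [h.a_mul_e]
  · rw [h.b_mul_c]
  · rw [h.b_mul_d]
  · rw [h.b_mul_e]
  · rw [h.c_mul_d]
  · rw [h.c_mul_e]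
  · rw [h.d_mul_e]
  · rw [h.linear_abc, map_zero]
  · rw [h.linear_bcd, map_zero]
  · rw [h.linear_acd, map_zero]
  · rw [h.linear_abd, map_zero]

/-- Specializing `u, v, x, y` to `0` and `w` to `z`, the socle is spanned by `z * e`. -/
lemma socle_iff {K : Type*} [Field K] (κ : K →+* S)
    (h : SquareRootRelations 0 0 z 0 0 z a b c d e)
    (hspan : ∀ q, ∃ k₀ k₁ k₂ k₃ k₄ k₅ k₆ k₇ : K, q = κ k₀ + κ k₁ * z + κ k₂ * e + κ k₃ * (z * e) +
      κ k₄ * a + κ k₅ * b + κ k₆ * c + κ k₇ * d)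
    (hze : z * e ≠ 0) (q : S) :
    (z * q = 0 ∧ a * q = 0 ∧ b * q = 0 ∧ c * q = 0 ∧ d * q = 0 ∧ e * q = 0) ↔
      ∃ k, q = κ k * (z * e) := by
  obtain ⟨hzz, haa, hbb, hcc, hdd, hee, hab, hac, had, hae, hbc, hbd, hbe, hcd, hce, hde,
    hzc, hzb, hza, hzd⟩ := h
  simp only [zero_mul, mul_zero, zero_add, add_zero] at *
  constructor
  · rintro ⟨hz, ha, hb, hc, hd, he⟩
    have hk : ∀ {k : K}, κ k * (z * e) = 0 → k = 0 := by
      intro k hk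
      by_contra hk0
      apply hze
      rw [← one_mul (z * e), ← map_one κ, ← inv_mul_cancel₀ hk0, map_mul, mul_assoc, hk, mul_zero]
    obtain ⟨k₀, k₁, k₂, k₃, k₄, k₅, k₆, k₇, rfl⟩ := hspan q
    obtain rfl : k₀ = 0 := hk (by
      linear_combination z * he - (κ k₁ * e + κ k₃ * e ^ 2) * hzz - κ k₂ * z * hee -
        κ k₄ * z * hae - κ k₅ * z * hbe - κ k₆ * z * hce - κ k₇ * z * hde)
    obtain rfl : k₁ = 0 := hk (by
      rw [map_zero] at he
      linear_combination he - (κ k₂ + κ k₃ * z) * hee - κ k₄ * hae - κ k₅ * hbe - κ k₆ * hce -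
        κ k₇ * hde)
    obtain rfl : k₂ = 0 := hk (by
      simp only [map_zero] at hz
      linear_combination hz - κ k₃ * e * hzz - κ k₄ * hza - κ k₅ * hzb - κ k₆ * hzc - κ k₇ * hzd)
    simp only [map_zero] at ha hb hc hd
    have h₅ : k₅ = 0 := hk (by
      linear_combination ha - κ k₃ * z * hae - κ k₄ * haa - κ k₅ * hab - κ k₆ * hac - κ k₇ * had)
    have h₄ : k₄ = 0 := hk (by
      linear_combination hb - κ k₃ * z * hbe - κ k₄ * hab - κ k₅ * hbb - κ k₆ * hbc - κ k₇ * hbd)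
    have h₇ : k₇ = 0 := hk (by
      linear_combination hc - κ k₃ * z * hce - κ k₄ * hac - κ k₅ * hbc - κ k₆ * hcc - κ k₇ * hcd)
    have h₆ : k₆ = 0 := hk (by
      linear_combination hd - κ k₃ * z * hde - κ k₄ * had - κ k₅ * hbd - κ k₆ * hcd - κ k₇ * hdd)
    exact ⟨k₃, by simp [h₄, h₅, h₆, h₇]⟩
  · rintro ⟨k, rfl⟩
    refine ⟨?_, ?_, ?_, ?_, ?_, ?_⟩
    · linear_combination κ k * e * hzz
    · linear_combination κ k * z * hae
    · linear_combination κ k * z * hbe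
    · linear_combination κ k * z * hce
    · linear_combination κ k * z * hde
    · linear_combination κ k * z * hee

end CommRing

section Adjoin

variable {B S : Type*} [CommRing B] [CommRing S] [Algebra B S] {u v w x y z : B} {a b c d e : S}

/-- The `B`-algebra generated by `a, b, c, d, e` is spanned by `1, a, b, c, d, e`. -/
lemma exists_eq_of_mem_adjoin
    (h : SquareRootRelations (algebraMap B S u) (algebraMap B S v) (algebraMap B S w)
      (algebraMap B S x) (algebraMap B S y) (algebraMap B S z) a b c d e)
    {r : S} (hr : r ∈ Algebra.adjoin B {a, b, c, d, e}) :
    ∃ r₀ r₁ r₂ r₃ r₄ r₅ : B, r = algebraMap B S r₀ + algebraMap B S r₁ * a +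
      algebraMap B S r₂ * b + algebraMap B S r₃ * c + algebraMap B S r₄ * d +
      algebraMap B S r₅ * e := by
  induction hr using Algebra.adjoin_induction with
  | mem r hr =>
    rcases hr with rfl | rfl | rfl | rfl | rfl
    · exact ⟨0, 1, 0, 0, 0, 0, by simp⟩
    · exact ⟨0, 0, 1, 0, 0, 0, by simp⟩
    · exact ⟨0, 0, 0, 1, 0, 0, by simp⟩
    · exact ⟨0, 0, 0, 0, 1, 0, by simp⟩
    · exact ⟨0, 0, 0, 0, 0, 1, by simp⟩
  | algebraMap r => exact ⟨r, 0, 0, 0, 0, 0, by simp⟩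
  | add r s _ _ hr hs =>
    obtain ⟨r₀, r₁, r₂, r₃, r₄, r₅, rfl⟩ := hr
    obtain ⟨s₀, s₁, s₂, s₃, s₄, s₅, rfl⟩ := hs
    refine ⟨r₀ + s₀, r₁ + s₁, r₂ + s₂, r₃ + s₃, r₄ + s₄, r₅ + s₅, ?_⟩
    simp only [map_add]
    ring
  | mul r s _ _ hr hs =>
    obtain ⟨r₀, r₁, r₂, r₃, r₄, r₅, rfl⟩ := hr
    obtain ⟨s₀, s₁, s₂, s₃, s₄, s₅, rfl⟩ := hs
    refine ⟨r₀ * s₀ + r₁ * s₁ * (u * y * z) + r₂ * s₂ * (v * x * z) + r₃ * s₃ * (w * x * y) +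
        r₄ * s₄ * (u * v * w) + r₅ * s₅ * (v * w * y * z) + (r₁ * s₂ + r₂ * s₁) * (z * v * y) +
        (r₁ * s₃ + r₃ * s₁) * (y * w * z) + (r₂ * s₄ + r₄ * s₂) * (v * w * z) +
        (r₃ * s₄ + r₄ * s₃) * (w * v * y),
      r₀ * s₁ + r₁ * s₀ + (r₄ * s₅ + r₅ * s₄) * (v * w),
      r₀ * s₂ + r₂ * s₀ + (r₃ * s₅ + r₅ * s₃) * (w * y),
      r₀ * s₃ + r₃ * s₀ + (r₂ * s₅ + r₅ * s₂) * (v * z),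
      r₀ * s₄ + r₄ * s₀ + (r₁ * s₅ + r₅ * s₁) * (y * z),
      r₀ * s₅ + r₅ * s₀ + (r₁ * s₂ + r₂ * s₁) * z + (r₁ * s₃ + r₃ * s₁) * y +
        (r₁ * s₄ + r₄ * s₁) * u + (r₂ * s₃ + r₃ * s₂) * x + (r₂ * s₄ + r₄ * s₂) * v +
        (r₃ * s₄ + r₄ * s₃) * w, ?_⟩
    simp only [map_add, map_mul]
    generalize algebraMap B S r₀ = r₀, algebraMap B S r₁ = r₁, algebraMap B S r₂ = r₂,
      algebraMap B S r₃ = r₃, algebraMap B S r₄ = r₄, algebraMap B S r₅ = r₅,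
      algebraMap B S s₀ = s₀, algebraMap B S s₁ = s₁, algebraMap B S s₂ = s₂,
      algebraMap B S s₃ = s₃, algebraMap B S s₄ = s₄, algebraMap B S s₅ = s₅
    linear_combination r₁ * s₁ * h.a_sq + r₂ * s₂ * h.b_sq + r₃ * s₃ * h.c_sq +
      r₄ * s₄ * h.d_sq + r₅ * s₅ * h.e_sq + (r₁ * s₂ + r₂ * s₁) * h.a_mul_b +
      (r₁ * s₃ + r₃ * s₁) * h.a_mul_c + (r₁ * s₄ + r₄ * s₁) * h.a_mul_d +
      (r₁ * s₅ + r₅ * s₁) * h.a_mul_e + (r₂ * s₃ + r₃ * s₂) * h.b_mul_c +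
      (r₂ * s₄ + r₄ * s₂) * h.b_mul_d + (r₂ * s₅ + r₅ * s₂) * h.b_mul_e +
      (r₃ * s₄ + r₄ * s₃) * h.c_mul_d + (r₃ * s₅ + r₅ * s₃) * h.c_mul_e +
      (r₄ * s₅ + r₅ * s₄) * h.d_mul_e

end Adjoin

end SquareRootRelations

section Extension

variable (K : Type) [Field K] [(mIdeal K).IsPrime] [IsDomain (Aring K)]

lemma algebraMap_Omega_injective : Function.Injective (algebraMap (Aring K) (Omega K)) :=
  (algebraMap (Lfield K) (Omega K)).injective.comp
    (IsFractionRing.injective (Aring K) (FractionRing (Aring K)))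

variable {K} {a b c d e : Omega K}

lemma squareRootRelations_adjoinT [CharP K 2]
    (ha : a ^ 2 = toOmega K (uElt K * yElt K * zElt K))
    (hb : b ^ 2 = toOmega K (vElt K * xElt K * zElt K))
    (hc : c ^ 2 = toOmega K (wElt K * xElt K * yElt K))
    (hd : d ^ 2 = toOmega K (uElt K * vElt K * wElt K))
    (he : e ^ 2 = toOmega K (vElt K * wElt K * yElt K * zElt K)) :
    SquareRootRelations (uT K a b c d e) (vT K a b c d e) (wT K a b c d e) (xT K a b c d e)
      (yT K a b c d e) (zT K a b c d e) (aT K a b c d e) (bT K a b c d e) (cT K a b c d e)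
      (dT K a b c d e) (eT K a b c d e) := by
  have h2 : (2 : adjoinT K a b c d e) = 0 := by
    rw [← map_ofNat (algebraMap (Aring K) (adjoinT K a b c d e)) 2, two_eq_zero_A, map_zero]
  refine SquareRootRelations.of_sq h2 ?_ ?_ ?_ ?_ ?_ ?_
  · simp only [uT, vT, wT, xT, yT, zT, ← map_mul, ← map_add, quadric_relation, map_zero]
  all_goals
    simp only [uT, vT, wT, xT, yT, zT, ← map_mul]
    refine Subtype.ext ?_
    assumption

/-- `e` is linearly independent of `1, a, b, c, d` over `A`. -/
lemma eq_zero_of_mul_e_eq [CharP K 2]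
    (h : SquareRootRelations (toOmega K (uElt K)) (toOmega K (vElt K)) (toOmega K (wElt K))
      (toOmega K (xElt K)) (toOmega K (yElt K)) (toOmega K (zElt K)) a b c d e)
    {p q₀ q₁ q₂ q₃ q₄ : Aring K}
    (hp : toOmega K p * e = toOmega K q₀ + toOmega K q₁ * a + toOmega K q₂ * b +
      toOmega K q₃ * c + toOmega K q₄ * d) : p = 0 := by
  have hz : zElt K ≠ 0 := polyToA_X_ne_zero K 5
  have h2 : (2 : Omega K) = 0 := by
    rw [← map_ofNat (algebraMap (Aring K) (Omega K)) 2, two_eq_zero_A, map_zero]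
  refine (mul_eq_zero.1 (eq_zero_of_sq_combination K (p := p * zElt K) (q := q₀ * zElt K)
    (r := q₁ * zElt K - q₃ * xElt K - q₄ * vElt K)
    (s := q₂ * zElt K - q₃ * yElt K - q₄ * uElt K) ?_)).resolve_right hz
  apply algebraMap_Omega_injective K
  simp only [map_add, map_sub, map_mul, map_pow]
  simp only [toOmega] at h hp
  have hlin : algebraMap _ (Omega K) p * algebraMap _ (Omega K) (zElt K) * e =
      algebraMap _ (Omega K) q₀ * algebraMap _ (Omega K) (zElt K) +
      (algebraMap _ (Omega K) q₁ * algebraMap _ (Omega K) (zElt K) -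
        algebraMap _ (Omega K) q₃ * algebraMap _ (Omega K) (xElt K) -
        algebraMap _ (Omega K) q₄ * algebraMap _ (Omega K) (vElt K)) * a +
      (algebraMap _ (Omega K) q₂ * algebraMap _ (Omega K) (zElt K) -
        algebraMap _ (Omega K) q₃ * algebraMap _ (Omega K) (yElt K) -
        algebraMap _ (Omega K) q₄ * algebraMap _ (Omega K) (uElt K)) * b := by
    linear_combination algebraMap _ (Omega K) (zElt K) * hp +
      algebraMap _ (Omega K) q₃ * h.linear_abc + algebraMap _ (Omega K) q₄ * h.linear_abd
  rw [← h.e_sq, ← h.a_sq, ← h.b_sq]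
  generalize algebraMap _ (Omega K) p * algebraMap _ (Omega K) (zElt K) = p,
    algebraMap _ (Omega K) q₀ * algebraMap _ (Omega K) (zElt K) = q,
    (algebraMap _ (Omega K) q₁ * algebraMap _ (Omega K) (zElt K) -
        algebraMap _ (Omega K) q₃ * algebraMap _ (Omega K) (xElt K) -
        algebraMap _ (Omega K) q₄ * algebraMap _ (Omega K) (vElt K)) = r,
    (algebraMap _ (Omega K) q₂ * algebraMap _ (Omega K) (zElt K) -
        algebraMap _ (Omega K) q₃ * algebraMap _ (Omega K) (yElt K) -
        algebraMap _ (Omega K) q₄ * algebraMap _ (Omega K) (uElt K)) = s at hlin ⊢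
  linear_combination (p * e + (q + r * a + s * b)) * hlin +
    (q * (r * a) + q * (s * b) + r * a * (s * b)) * h2

lemma Iideal_eq_map :
    Iideal K a b c d e = (paramIdeal K).map (algebraMap (Aring K) (adjoinT K a b c d e)) := by
  rw [paramIdeal, Ideal.map_span]
  simp only [Set.image_insert_eq, Set.image_singleton, map_sub]
  rfl

lemma exists_eq_adjoinT
    (h : SquareRootRelations (toOmega K (uElt K)) (toOmega K (vElt K)) (toOmega K (wElt K))
      (toOmega K (xElt K)) (toOmega K (yElt K)) (toOmega K (zElt K)) a b c d e)
    (r : adjoinT K a b c d e) :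
    ∃ r₀ r₁ r₂ r₃ r₄ r₅ : Aring K, r = algebraMap _ _ r₀ +
      algebraMap _ _ r₁ * aT K a b c d e + algebraMap _ _ r₂ * bT K a b c d e +
      algebraMap _ _ r₃ * cT K a b c d e + algebraMap _ _ r₄ * dT K a b c d e +
      algebraMap _ _ r₅ * eT K a b c d e := by
  obtain ⟨r₀, r₁, r₂, r₃, r₄, r₅, hr⟩ := h.exists_eq_of_mem_adjoin r.2
  exact ⟨r₀, r₁, r₂, r₃, r₄, r₅, Subtype.ext hr⟩

/-- `ze` does not lie in `I`. -/
lemma zT_mul_eT_notMem [CharP K 2]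
    (h : SquareRootRelations (toOmega K (uElt K)) (toOmega K (vElt K)) (toOmega K (wElt K))
      (toOmega K (xElt K)) (toOmega K (yElt K)) (toOmega K (zElt K)) a b c d e) :
    zT K a b c d e * eT K a b c d e ∉ Iideal K a b c d e := by
  have key : ∀ r ∈ paramIdeal K • (⊤ : Submodule (Aring K) (adjoinT K a b c d e)),
      ∃ r₀ r₁ r₂ r₃ r₄ : Aring K, ∃ r₅ ∈ paramIdeal K, r = algebraMap _ _ r₀ +
        algebraMap _ _ r₁ * aT K a b c d e + algebraMap _ _ r₂ * bT K a b c d e +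
        algebraMap _ _ r₃ * cT K a b c d e + algebraMap _ _ r₄ * dT K a b c d e +
        algebraMap _ _ r₅ * eT K a b c d e := by
    intro r hr
    induction hr using Submodule.smul_induction_on' with
    | smul j hj r _ =>
      obtain ⟨r₀, r₁, r₂, r₃, r₄, r₅, rfl⟩ := exists_eq_adjoinT h r
      refine ⟨j * r₀, j * r₁, j * r₂, j * r₃, j * r₄, j * r₅, Ideal.mul_mem_right _ _ hj, ?_⟩
      simp only [map_mul, Algebra.smul_def]
      ring
    | add r _ s _ hr hs =>
      obtain ⟨r₀, r₁, r₂, r₃, r₄, r₅, hr₅, rfl⟩ := hr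
      obtain ⟨s₀, s₁, s₂, s₃, s₄, s₅, hs₅, rfl⟩ := hs
      refine ⟨r₀ + s₀, r₁ + s₁, r₂ + s₂, r₃ + s₃, r₄ + s₄, r₅ + s₅, add_mem hr₅ hs₅, ?_⟩
      simp only [map_add]
      ring
  intro hmem
  rw [Iideal_eq_map, ← Submodule.restrictScalars_mem (Aring K), ← Ideal.smul_top_eq_map] at hmem
  obtain ⟨r₀, r₁, r₂, r₃, r₄, r₅, hr₅, hr⟩ := key _ hmem
  have hr' : toOmega K (zElt K) * e = toOmega K r₀ + toOmega K r₁ * a + toOmega K r₂ * b +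
      toOmega K r₃ * c + toOmega K r₄ * d + toOmega K r₅ * e := congrArg Subtype.val hr
  have h0 : zElt K - r₅ = 0 := by
    refine eq_zero_of_mul_e_eq h (q₀ := r₀) (q₁ := r₁) (q₂ := r₂) (q₃ := r₃) (q₄ := r₄) ?_
    have hsub : toOmega K (zElt K - r₅) = toOmega K (zElt K) - toOmega K r₅ := map_sub _ _ _
    rw [hsub]
    linear_combination hr'
  exact zElt_notMem_paramIdeal K (sub_eq_zero.1 h0 ▸ hr₅)

end Extension

/-- The socle of `R/I` — the `K`-subspace of elements annihilated by the
images of each of `u, v, w, x, y, z, a, b, c, d, e` — is one-dimensional over `K`, spanned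
by the image of `ze`. -/
theorem socle_of_quotient_is_spanned_by_ze
    (K : Type) [Field K] [CharP K 2] [(mIdeal K).IsPrime] [IsDomain (Aring K)]
    (a b c d e : Omega K)
    (ha : a ^ 2 = toOmega K (uElt K * yElt K * zElt K))
    (hb : b ^ 2 = toOmega K (vElt K * xElt K * zElt K))
    (hc : c ^ 2 = toOmega K (wElt K * xElt K * yElt K))
    (hd : d ^ 2 = toOmega K (uElt K * vElt K * wElt K))
    (he : e ^ 2 = toOmega K (vElt K * wElt K * yElt K * zElt K)) :
    {q : adjoinT K a b c d e ⧸ Iideal K a b c d e |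
        ∀ g ∈ ({uT K a b c d e, vT K a b c d e, wT K a b c d e, xT K a b c d e,
          yT K a b c d e, zT K a b c d e, aT K a b c d e, bT K a b c d e, cT K a b c d e,
          dT K a b c d e, eT K a b c d e} : Set (adjoinT K a b c d e)),
          Ideal.Quotient.mk (Iideal K a b c d e) g * q = 0} =
      {q : adjoinT K a b c d e ⧸ Iideal K a b c d e |
        ∃ k : K, q = kToQuot K a b c d e k *
          Ideal.Quotient.mk (Iideal K a b c d e) (zT K a b c d e * eT K a b c d e)} ∧
    Ideal.Quotient.mk (Iideal K a b c d e) (zT K a b c d e * eT K a b c d e) ≠ 0 := by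
  have hT := squareRootRelations_adjoinT ha hb hc hd he
  have hΩ : SquareRootRelations (toOmega K (uElt K)) (toOmega K (vElt K)) (toOmega K (wElt K))
      (toOmega K (xElt K)) (toOmega K (yElt K)) (toOmega K (zElt K)) a b c d e :=
    hT.map (adjoinT K a b c d e).val.toRingHom
  have hze : Ideal.Quotient.mk (Iideal K a b c d e) (zT K a b c d e * eT K a b c d e) ≠ 0 :=
    fun h0 => zT_mul_eT_notMem hΩ (Ideal.Quotient.eq_zero_iff_mem.1 h0)
  refine ⟨?_, hze⟩
  have hQ := hT.map (Ideal.Quotient.mk (Iideal K a b c d e))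
  have hu : Ideal.Quotient.mk (Iideal K a b c d e) (uT K a b c d e) = 0 :=
    Ideal.Quotient.eq_zero_iff_mem.2 (Ideal.subset_span (by simp))
  have hv : Ideal.Quotient.mk (Iideal K a b c d e) (vT K a b c d e) = 0 :=
    Ideal.Quotient.eq_zero_iff_mem.2 (Ideal.subset_span (by simp))
  have hx : Ideal.Quotient.mk (Iideal K a b c d e) (xT K a b c d e) = 0 :=
    Ideal.Quotient.eq_zero_iff_mem.2 (Ideal.subset_span (by simp))
  have hy : Ideal.Quotient.mk (Iideal K a b c d e) (yT K a b c d e) = 0 :=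
    Ideal.Quotient.eq_zero_iff_mem.2 (Ideal.subset_span (by simp))
  have hw : Ideal.Quotient.mk (Iideal K a b c d e) (wT K a b c d e) =
      Ideal.Quotient.mk (Iideal K a b c d e) (zT K a b c d e) :=
    Ideal.Quotient.eq.2 (Ideal.subset_span (by simp))
  rw [hu, hv, hx, hy, hw] at hQ
  have hA : ∀ α : Aring K, ∃ k l : K,
      Ideal.Quotient.mk (Iideal K a b c d e) (algebraMap _ _ α) = kToQuot K a b c d e k +
        kToQuot K a b c d e l * Ideal.Quotient.mk (Iideal K a b c d e) (zT K a b c d e) := by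
    intro α
    obtain ⟨k, l, h⟩ := exists_sub_mem_paramIdeal K α
    refine ⟨k, l, ?_⟩
    have hmem := Ideal.mem_map_of_mem (algebraMap (Aring K) (adjoinT K a b c d e)) h
    rw [← Iideal_eq_map, map_sub, ← Ideal.Quotient.eq] at hmem
    rw [hmem, map_add, map_mul, map_add, map_mul]
    rfl
  have hspan : ∀ q : adjoinT K a b c d e ⧸ Iideal K a b c d e,
      ∃ k₀ k₁ k₂ k₃ k₄ k₅ k₆ k₇ : K, q = kToQuot K a b c d e k₀ +
        kToQuot K a b c d e k₁ * Ideal.Quotient.mk _ (zT K a b c d e) +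
        kToQuot K a b c d e k₂ * Ideal.Quotient.mk _ (eT K a b c d e) +
        kToQuot K a b c d e k₃ *
          (Ideal.Quotient.mk _ (zT K a b c d e) * Ideal.Quotient.mk _ (eT K a b c d e)) +
        kToQuot K a b c d e k₄ * Ideal.Quotient.mk _ (aT K a b c d e) +
        kToQuot K a b c d e k₅ * Ideal.Quotient.mk _ (bT K a b c d e) +
        kToQuot K a b c d e k₆ * Ideal.Quotient.mk _ (cT K a b c d e) +
        kToQuot K a b c d e k₇ * Ideal.Quotient.mk _ (dT K a b c d e) := by
    intro q
    obtain ⟨r, rfl⟩ := Ideal.Quotient.mk_surjective q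
    obtain ⟨r₀, r₁, r₂, r₃, r₄, r₅, rfl⟩ := exists_eq_adjoinT hΩ r
    obtain ⟨k₀, l₀, h₀⟩ := hA r₀
    obtain ⟨k₁, l₁, h₁⟩ := hA r₁
    obtain ⟨k₂, l₂, h₂⟩ := hA r₂
    obtain ⟨k₃, l₃, h₃⟩ := hA r₃
    obtain ⟨k₄, l₄, h₄⟩ := hA r₄
    obtain ⟨k₅, l₅, h₅⟩ := hA r₅
    refine ⟨k₀, l₀, k₅, l₅, k₁, k₂, k₃, k₄, ?_⟩
    simp only [map_add, map_mul, h₀, h₁, h₂, h₃, h₄, h₅]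
    linear_combination kToQuot K a b c d e l₁ * hQ.linear_acd +
      kToQuot K a b c d e l₂ * hQ.linear_bcd + kToQuot K a b c d e l₃ * hQ.linear_abc +
      kToQuot K a b c d e l₄ * hQ.linear_abd
  ext q
  have key := hQ.socle_iff (kToQuot K a b c d e) hspan (by rwa [← map_mul]) q
  simp only [Set.mem_ofPred_eq, Set.mem_insert_iff, Set.mem_singleton_iff, forall_eq_or_imp,
    forall_eq, hu, hv, hx, hy, hw, zero_mul, true_and, map_mul]
  rw [← key]
  tauto
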